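/- Let d ≥ 2 be an integer, α ∈ (0,2), and r ∈ (0,1). Then α · (B(d/2-α/2, α/2)/B(d/2, α/2)) · ∫_0^r s^{α-1} (1 - I(s^2; d/2-α/2, α/2)) ds = I(r^2; d/2, α/2) + r^α · (B(d/2-α/2, α/2)/B(d/2, α/2)) · (1 - I(r^2; d/2-α/2, α/2)). -/

import Mathlib

open Real MeasureTheory

/-- Beta function B(z,w) = Γ(z)Γ(w)/Γ(z+w). -/
noncomputable def betaFn (z w : ℝ) : ℝ :=
  Real.Gamma z * Real.Gamma w / Real.Gamma (z + w)

/-- Regularized incomplete Beta function I(x; z, w). -/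
noncomputable def regIncBeta (x z w : ℝ) : ℝ :=
  (∫ u in (0:ℝ)..x, u ^ (z - 1) * (1 - u) ^ (w - 1)) / betaFn z w

lemma betaFn_pos {z w : ℝ} (hz : 0 < z) (hw : 0 < w) : 0 < betaFn z w :=
  div_pos (mul_pos (Gamma_pos_of_pos hz) (Gamma_pos_of_pos hw)) (Gamma_pos_of_pos (add_pos hz hw))

lemma intervalIntegrable_beta_integrand {z : ℝ} (hz : 0 < z) (w : ℝ) {x : ℝ} (hx₀ : 0 ≤ x)
    (hx : x < 1) :
    IntervalIntegrable (fun u : ℝ => u ^ (z - 1) * (1 - u) ^ (w - 1)) volume 0 x := by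
  refine (intervalIntegral.intervalIntegrable_rpow' (by linarith)).mul_continuousOn ?_
  refine ContinuousOn.rpow_const (by fun_prop) fun u hu => Or.inl ?_
  rw [Set.uIcc_of_le hx₀] at hu
  linarith [hu.2]

lemma continuousOn_regIncBeta {z : ℝ} (hz : 0 < z) (w : ℝ) {x : ℝ} (hx₀ : 0 ≤ x) (hx : x < 1) :
    ContinuousOn (fun y => regIncBeta y z w) (Set.Icc 0 x) := by
  have h := intervalIntegral.continuousOn_primitive_interval'
    (intervalIntegrable_beta_integrand hz w hx₀ hx) Set.left_mem_uIcc
  rw [Set.uIcc_of_le hx₀] at h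
  exact h.div_const _

lemma hasDerivAt_regIncBeta {z : ℝ} (hz : 0 < z) (w : ℝ) {x : ℝ} (hx₀ : 0 < x) (hx : x < 1) :
    HasDerivAt (fun y => regIncBeta y z w)
      (x ^ (z - 1) * (1 - x) ^ (w - 1) / betaFn z w) x := by
  have hc : ContinuousOn (fun u : ℝ => u ^ (z - 1) * (1 - u) ^ (w - 1)) (Set.Ioo 0 1) := by
    refine ContinuousOn.mul ?_ ?_
    · exact ContinuousOn.rpow_const continuousOn_id fun u hu => Or.inl hu.1.ne'
    · exact ContinuousOn.rpow_const (by fun_prop) fun u hu => Or.inl (by linarith [hu.2])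
  have hm : x ∈ Set.Ioo (0 : ℝ) 1 := ⟨hx₀, hx⟩
  exact (intervalIntegral.integral_hasDerivAt_right
    (intervalIntegrable_beta_integrand hz w hx₀.le hx)
    (hc.stronglyMeasurableAtFilter isOpen_Ioo x hm)
    (hc.continuousAt (isOpen_Ioo.mem_nhds hm))).div_const _

lemma continuousOn_regIncBeta_sq {z : ℝ} (hz : 0 < z) (w : ℝ) {r : ℝ} (hr₀ : 0 < r)
    (hr : r < 1) : ContinuousOn (fun s => regIncBeta (s ^ 2) z w) (Set.Icc 0 r) :=
  (continuousOn_regIncBeta hz w (sq_nonneg r) (by nlinarith)).comp (t := Set.Icc 0 (r ^ 2))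
    (by fun_prop) fun s hs => ⟨sq_nonneg s, pow_le_pow_left₀ hs.1 hs.2 2⟩

lemma hasDerivAt_regIncBeta_sq {z : ℝ} (hz : 0 < z) (w : ℝ) {s : ℝ} (hs₀ : 0 < s) (hs : s < 1) :
    HasDerivAt (fun y => regIncBeta (y ^ 2) z w)
      ((s ^ 2) ^ (z - 1) * (1 - s ^ 2) ^ (w - 1) / betaFn z w * (2 * s)) s := by
  have h := hasDerivAt_regIncBeta hz w (x := s ^ 2) (by positivity) (by nlinarith)
  exact (HasDerivAt.comp (h := fun y : ℝ => y ^ 2) s h (hasDerivAt_pow 2 s)).congr_deriv (by simp)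

/-- Integration of `s ^ (2 * b - 1) * (1 - I(s ^ 2; a, b))` by parts. -/
lemma integral_rpow_mul_one_sub_regIncBeta {a b r : ℝ} (ha : 0 < a) (hb : 0 < b) (hr₀ : 0 < r)
    (hr : r < 1) :
    2 * b * (betaFn a b / betaFn (a + b) b) *
        (∫ s in (0:ℝ)..r, s ^ (2 * b - 1) * (1 - regIncBeta (s ^ 2) a b))
      = regIncBeta (r ^ 2) (a + b) b
        + r ^ (2 * b) * (betaFn a b / betaFn (a + b) b) * (1 - regIncBeta (r ^ 2) a b) := by
  have hB := betaFn_pos ha hb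
  have hB' := betaFn_pos (add_pos ha hb) hb
  set C := betaFn a b / betaFn (a + b) b with hC
  have hcont := continuousOn_regIncBeta_sq ha b hr₀ hr
  have key := intervalIntegral.integral_eq_sub_of_hasDerivAt_of_le hr₀.le
    (f := fun s => regIncBeta (s ^ 2) (a + b) b + s ^ (2 * b) * C * (1 - regIncBeta (s ^ 2) a b))
    (f' := fun s => 2 * b * C * (s ^ (2 * b - 1) * (1 - regIncBeta (s ^ 2) a b))) ?_ ?_ ?_
  · rw [intervalIntegral.integral_const_mul] at key
    rw [key]
    simp [regIncBeta, zero_rpow (show 2 * b ≠ 0 by positivity)]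
  · refine (continuousOn_regIncBeta_sq (add_pos ha hb) b hr₀ hr).add
      (ContinuousOn.mul ?_ (continuousOn_const.sub hcont))
    exact (continuous_id.rpow_const fun _ => Or.inr (by positivity)).continuousOn.mul_const C
  · intro s hs
    have hs₁ : s < 1 := hs.2.trans hr
    have h := (hasDerivAt_regIncBeta_sq (add_pos ha hb) b hs.1 hs₁).add
      (((hasDerivAt_rpow_const (p := 2 * b) (Or.inl hs.1.ne')).mul_const C).mul
        ((hasDerivAt_regIncBeta_sq ha b hs.1 hs₁).const_sub 1))
    refine h.congr_deriv ?_
    have hpow : (s ^ 2) ^ (a + b - 1) = s ^ (2 * b) * (s ^ 2) ^ (a - 1) := by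
      rw [show a + b - 1 = b + (a - 1) by ring, rpow_add (pow_pos hs.1 2), ← rpow_natCast_mul hs.1.le]
      norm_num
    rw [hpow, hC]
    field_simp
    ring
  · refine ((intervalIntegral.intervalIntegrable_rpow' (by linarith)).mul_continuousOn
      ?_).const_mul _
    rw [Set.uIcc_of_le hr₀.le]
    exact continuousOn_const.sub hcont

theorem stmt9 (d : ℕ) (hd : 2 ≤ d) (α : ℝ) (hα : α ∈ Set.Ioo (0:ℝ) 2)
    (r : ℝ) (hr : r ∈ Set.Ioo (0:ℝ) 1) :
    α * (betaFn ((d:ℝ)/2 - α/2) (α/2) / betaFn ((d:ℝ)/2) (α/2)) *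
        (∫ s in (0:ℝ)..r, s ^ (α - 1) * (1 - regIncBeta (s^2) ((d:ℝ)/2 - α/2) (α/2)))
      = regIncBeta (r^2) ((d:ℝ)/2) (α/2)
        + r ^ α * (betaFn ((d:ℝ)/2 - α/2) (α/2) / betaFn ((d:ℝ)/2) (α/2))
            * (1 - regIncBeta (r^2) ((d:ℝ)/2 - α/2) (α/2)) := by
  have hd' : (2:ℝ) ≤ d := by exact_mod_cast hd
  have h := integral_rpow_mul_one_sub_regIncBeta (a := (d:ℝ)/2 - α/2) (b := α/2)
    (by linarith [hα.2]) (by linarith [hα.1]) hr.1 hr.2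
  rwa [mul_div_cancel₀ α two_ne_zero, sub_add_cancel] at h
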